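/- (PAC-Bayes-quadratic bound.) Let 𝒵 be a measurable space, P a probability measure on 𝒵, 𝒲 a measurable space, and ℓ : 𝒲 × 𝒵 → ℝ a jointly measurable loss function taking values in [0,1]. Define the risk L(w) = ∫ ℓ(w,z) dP(z) and, for a sample z = (z₁,…,zₙ) ∈ 𝒵ⁿ, the empirical risk L̂ₙ(w, z) = (1/n)·Σᵢ₌₁ⁿ ℓ(w, zᵢ). Fix a probability measure Q⁰ on 𝒲 (the prior), an integer n ≥ 1, and δ ∈ (0,1). Then, with probability at least 1 − δ over samples z = (z₁,…,zₙ) drawn i.i.d. from P (i.e., with respect to the n-fold product measure Pⁿ), simultaneously for all probability measures Q on 𝒲: ∫ L dQ ≤ ( √( ∫ L̂ₙ(·, z) dQ + (KL(Q ‖ Q⁰) + log(2√n/δ))/(2n) ) + √( (KL(Q ‖ Q⁰) + log(2√n/δ))/(2n) ) )². -/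

import Mathlib

open MeasureTheory

/-- The Kullback-Leibler divergence `KL(Q ‖ Q') = ∫ log (dQ/dQ') dQ`, as a real
number.  This is the correct value whenever `Q ≪ Q'` and the log-density is
`Q`-integrable, i.e. whenever the KL divergence is finite. -/
noncomputable def klDiv {α : Type*} [MeasurableSpace α] (Q Q' : Measure α) : ℝ :=
  ∫ x, Real.log ((Q.rnDeriv Q') x).toReal ∂Q

/-- The standardized amount `√n (p - q) / √p` by which an empirical mean `q` of `n` samples falls
short of the true mean `p`. -/
noncomputable def standardizedDeficit (n : ℕ) (p q : ℝ) : ℝ :=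
  Real.sqrt n * (p - q) / Real.sqrt p

lemma standardizedDeficit_le_sqrt {n : ℕ} {p q : ℝ} (hp : p ∈ Set.Icc (0 : ℝ) 1) (hq : 0 ≤ q) :
    standardizedDeficit n p q ≤ Real.sqrt n := by
  unfold standardizedDeficit
  rcases hp.1.eq_or_lt with h | h
  · simp [← h]
  · have hs : 0 < Real.sqrt p := Real.sqrt_pos.2 h
    have hs1 : Real.sqrt p ≤ 1 := Real.sqrt_le_one.2 hp.2
    have hps : p ≤ Real.sqrt p := by nlinarith [Real.mul_self_sqrt hp.1]
    rw [div_le_iff₀ hs]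
    exact mul_le_mul_of_nonneg_left (by linarith) (Real.sqrt_nonneg _)

lemma sq_max_standardizedDeficit_div_two_le {n : ℕ} {p q : ℝ} (hp : p ∈ Set.Icc (0 : ℝ) 1)
    (hq : 0 ≤ q) : (max (standardizedDeficit n p q) 0) ^ 2 / 2 ≤ n / 2 := by
  have h1 : max (standardizedDeficit n p q) 0 ≤ Real.sqrt n :=
    max_le (standardizedDeficit_le_sqrt hp hq) (Real.sqrt_nonneg _)
  have h2 := pow_le_pow_left₀ (le_max_right _ _) h1 2
  rw [Real.sq_sqrt n.cast_nonneg] at h2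
  linarith

/-- The tangent-line lower bound of the jointly convex function `(p, q) ↦ (p - q)₊² / p`. -/
lemma tangent_le_sq_max_standardizedDeficit {n : ℕ} {p q t : ℝ} (hp : 0 ≤ p) (hq : 0 ≤ q)
    (ht : 0 ≤ t) :
    n * (t * (p - q) - t ^ 2 * p / 2) ≤ (max (standardizedDeficit n p q) 0) ^ 2 / 2 := by
  have hn : (0 : ℝ) ≤ n := n.cast_nonneg
  rcases le_or_gt p q with hpq | hpq
  · have : t * (p - q) - t ^ 2 * p / 2 ≤ 0 := by
      nlinarith [mul_nonneg ht (sub_nonneg.2 hpq), mul_nonneg (sq_nonneg t) hp]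
    exact (mul_nonpos_of_nonneg_of_nonpos hn this).trans (by positivity)
  · have hp' : 0 < p := hq.trans_lt hpq
    have h0 : 0 ≤ standardizedDeficit n p q := by
      unfold standardizedDeficit
      have := sub_nonneg.2 hpq.le
      positivity
    rw [max_eq_left h0]
    have hsq : standardizedDeficit n p q ^ 2 = n * ((p - q) ^ 2 / p) := by
      unfold standardizedDeficit
      rw [div_pow, mul_pow, Real.sq_sqrt hn, Real.sq_sqrt hp]
      ring
    have hkey : 2 * (t * (p - q)) - t ^ 2 * p ≤ (p - q) ^ 2 / p := by
      rw [le_div_iff₀ hp']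
      nlinarith [sq_nonneg (p - q - t * p)]
    rw [hsq]
    nlinarith [mul_le_mul_of_nonneg_left hkey hn]

lemma exp_neg_le_quadratic {x : ℝ} (hx : 0 ≤ x) : Real.exp (-x) ≤ 1 - x + x ^ 2 / 2 := by
  have h := Real.quadratic_le_exp_of_nonneg hx
  rw [Real.exp_neg, inv_le_iff_one_le_mul₀ (Real.exp_pos x)]
  have hpos : 0 ≤ 1 - x + x ^ 2 / 2 := by nlinarith [sq_nonneg (x - 1)]
  nlinarith [mul_le_mul_of_nonneg_left h hpos, pow_nonneg hx 4]

lemma integral_exp_mul_mean_sub_le {α : Type*} [MeasurableSpace α] {μ : Measure α}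
    [IsProbabilityMeasure μ] {X : α → ℝ} (hX : Measurable X)
    (hb : ∀ a, X a ∈ Set.Icc (0 : ℝ) 1) {s : ℝ} (hs : 0 ≤ s) :
    ∫ a, Real.exp (s * ((∫ b, X b ∂μ) - X a)) ∂μ ≤ Real.exp (s ^ 2 * (∫ b, X b ∂μ) / 2) := by
  have hXi : Integrable X μ := Integrable.of_mem_Icc 0 1 hX.aemeasurable (ae_of_all _ hb)
  set p := ∫ b, X b ∂μ with hp
  have hpt : ∀ a, Real.exp (s * (p - X a)) ≤
      Real.exp (s * p) * (1 + (s ^ 2 / 2 - s) * X a) := by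
    intro a
    have h1 := exp_neg_le_quadratic (mul_nonneg hs (hb a).1)
    have h2 : Real.exp (s * (p - X a)) = Real.exp (s * p) * Real.exp (-(s * X a)) := by
      rw [← Real.exp_add]; ring_nf
    rw [h2]
    refine mul_le_mul_of_nonneg_left (h1.trans ?_) (Real.exp_pos _).le
    have : X a ^ 2 ≤ X a := by nlinarith [(hb a).1, (hb a).2]
    nlinarith [mul_le_mul_of_nonneg_left this (sq_nonneg s)]
  have hi : Integrable (fun a => Real.exp (s * p) * (1 + (s ^ 2 / 2 - s) * X a)) μ :=
    ((integrable_const 1).add (hXi.const_mul _)).const_mul _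
  calc ∫ a, Real.exp (s * (p - X a)) ∂μ
      ≤ ∫ a, Real.exp (s * p) * (1 + (s ^ 2 / 2 - s) * X a) ∂μ :=
        integral_mono_of_nonneg (ae_of_all _ fun a => (Real.exp_pos _).le) hi (ae_of_all _ hpt)
    _ = Real.exp (s * p) * (1 + (s ^ 2 / 2 - s) * p) := by
        rw [integral_const_mul, integral_add (integrable_const _) (hXi.const_mul _),
          integral_const_mul]
        simp [hp]
    _ ≤ Real.exp (s * p) * Real.exp ((s ^ 2 / 2 - s) * p) := by
        refine mul_le_mul_of_nonneg_left ?_ (Real.exp_pos _).le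
        linarith [Real.add_one_le_exp ((s ^ 2 / 2 - s) * p)]
    _ = Real.exp (s ^ 2 * p / 2) := by rw [← Real.exp_add]; ring_nf

lemma integral_exp_mul_standardizedDeficit_le {α : Type*} [MeasurableSpace α] {μ : Measure α}
    [IsProbabilityMeasure μ] {X : α → ℝ} (hX : Measurable X)
    (hb : ∀ a, X a ∈ Set.Icc (0 : ℝ) 1) {n : ℕ} (hn : 1 ≤ n) {s : ℝ} (hs : 0 ≤ s) :
    ∫ z : Fin n → α, Real.exp (s * standardizedDeficit n (∫ b, X b ∂μ)
        ((1 / (n : ℝ)) * ∑ i, X (z i))) ∂(Measure.pi fun _ => μ) ≤ Real.exp (s ^ 2 / 2) := by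
  set p := ∫ b, X b ∂μ with hp
  have hp0 : 0 ≤ p := integral_nonneg fun a => (hb a).1
  have hn0 : (0 : ℝ) < n := by exact_mod_cast hn
  have hsn : 0 < Real.sqrt n := Real.sqrt_pos.2 hn0
  have hsn2 : Real.sqrt n ^ 2 = n := Real.sq_sqrt hn0.le
  set u := s / (Real.sqrt n * Real.sqrt p) with hu
  have hprod : ∀ z : Fin n → α, Real.exp (s * standardizedDeficit n p
      ((1 / (n : ℝ)) * ∑ i, X (z i))) = ∏ i, Real.exp (u * (p - X (z i))) := by
    intro z
    rw [← Real.exp_sum, ← Finset.mul_sum, Finset.sum_sub_distrib]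
    simp only [Finset.sum_const, Finset.card_univ, Fintype.card_fin, nsmul_eq_mul]
    congr 1
    unfold standardizedDeficit
    rw [hu, show s / (Real.sqrt n * Real.sqrt p) = s / Real.sqrt n / Real.sqrt p by
      rw [div_div]]
    have : n * p - ∑ i, X (z i)
        = Real.sqrt n * (Real.sqrt n * (p - (1 / (n : ℝ)) * ∑ i, X (z i))) := by
      rw [← mul_assoc, ← sq, hsn2]
      field_simp
    rw [this]
    field_simp
  simp_rw [hprod]
  rw [integral_fintype_prod_eq_prod (fun _ : Fin n => fun a => Real.exp (u * (p - X a)))]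
  calc ∏ _i : Fin n, ∫ a, Real.exp (u * (p - X a)) ∂μ
      ≤ ∏ _i : Fin n, Real.exp (u ^ 2 * p / 2) :=
        Finset.prod_le_prod (fun _ _ => integral_nonneg fun _ => (Real.exp_pos _).le)
          fun _ _ => integral_exp_mul_mean_sub_le hX hb (by positivity)
    _ = Real.exp (n * (u ^ 2 * p / 2)) := by
        rw [Finset.prod_const, Finset.card_univ, Fintype.card_fin, Real.exp_nat_mul]
    _ ≤ Real.exp (s ^ 2 / 2) := by
        refine Real.exp_le_exp.2 ?_
        rcases hp0.eq_or_lt with h | h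
        · rw [← h]; simp; positivity
        · rw [hu, div_pow, mul_pow, hsn2, Real.sq_sqrt hp0]
          apply le_of_eq
          field_simp

/-- A finite mixture of exponentials with slopes at the odd integers dominates `exp (x₊² / 2)`. -/
lemma exp_sq_max_div_two_le_sum {x : ℝ} {k : ℕ} (hx : x ≤ 2 * k) :
    Real.exp ((max x 0) ^ 2 / 2) ≤ 1 + Real.exp (1 / 2) * ∑ j ∈ Finset.range k,
      Real.exp (-((2 * (j : ℝ) + 1) ^ 2 / 2)) * Real.exp ((2 * (j : ℝ) + 1) * x) := by
  rcases le_or_gt x 0 with h | h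
  · rw [max_eq_right h]
    simp only [ne_eq, OfNat.ofNat_ne_zero, not_false_eq_true, zero_pow, zero_div, Real.exp_zero,
      le_add_iff_nonneg_right]
    positivity
  · rw [max_eq_left h.le]
    obtain ⟨j, hj⟩ : ∃ j, ⌈x / 2⌉₊ = j + 1 :=
      Nat.exists_eq_succ_of_ne_zero (Nat.ceil_pos.2 (by positivity)).ne'
    have hle : x / 2 ≤ (j : ℝ) + 1 := by
      have := Nat.le_ceil (x / 2)
      rw [hj] at this
      exact_mod_cast this
    have hlt : (j : ℝ) + 1 < x / 2 + 1 := by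
      have := Nat.ceil_lt_add_one (a := x / 2) (by positivity)
      rw [hj] at this
      exact_mod_cast this
    have hjk : j < k := by
      have : ⌈x / 2⌉₊ ≤ k := Nat.ceil_le.2 (by linarith)
      omega
    have hterm : Real.exp (x ^ 2 / 2) ≤ Real.exp (1 / 2) *
        (Real.exp (-((2 * (j : ℝ) + 1) ^ 2 / 2)) * Real.exp ((2 * (j : ℝ) + 1) * x)) := by
      rw [← Real.exp_add, ← Real.exp_add]
      refine Real.exp_le_exp.2 ?_
      nlinarith
    have hsum := Finset.single_le_sum (f := fun j : ℕ =>
      Real.exp (-((2 * (j : ℝ) + 1) ^ 2 / 2)) * Real.exp ((2 * (j : ℝ) + 1) * x))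
      (fun i _ => by positivity) (Finset.mem_range.2 hjk)
    have := mul_le_mul_of_nonneg_left hsum (Real.exp_pos (1 / 2)).le
    linarith

lemma exp_half_le : Real.exp (1 / 2) ≤ 1.65 := by
  have h : Real.exp (1 / 2) ^ 2 = Real.exp 1 := by rw [← Real.exp_nat_mul]; norm_num
  have := Real.exp_one_lt_d9
  nlinarith [Real.exp_pos (1 / 2)]

lemma exists_grid_size {n : ℕ} (hn : 2 ≤ n) :
    ∃ k : ℕ, Real.sqrt n ≤ 2 * k ∧ 1 + Real.exp (1 / 2) * k ≤ 2 * Real.sqrt n := by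
  have he := exp_half_le
  have hs : Real.sqrt n ^ 2 = n := Real.sq_sqrt n.cast_nonneg
  have hs0 := Real.sqrt_nonneg (n : ℝ)
  rcases le_or_gt n 4 with h4 | h4
  · have h1 : (2 : ℝ) ≤ n := by exact_mod_cast hn
    have h2 : (n : ℝ) ≤ 4 := by exact_mod_cast h4
    refine ⟨1, ?_, ?_⟩ <;> push_cast <;> nlinarith
  rcases le_or_gt n 16 with h16 | h16
  · have h1 : (5 : ℝ) ≤ n := by exact_mod_cast h4
    have h2 : (n : ℝ) ≤ 16 := by exact_mod_cast h16
    refine ⟨2, ?_, ?_⟩ <;> push_cast <;> nlinarith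
  · have h1 : (16 : ℝ) < n := by exact_mod_cast h16
    have h4 : 4 < Real.sqrt n := by nlinarith
    have hc := Nat.le_ceil (Real.sqrt n / 2)
    have hc' := Nat.ceil_lt_add_one (a := Real.sqrt n / 2) (by positivity)
    refine ⟨⌈Real.sqrt n / 2⌉₊, by linarith, ?_⟩
    nlinarith

lemma integral_exp_sq_max_standardizedDeficit_le {α : Type*} [MeasurableSpace α] {μ : Measure α}
    [IsProbabilityMeasure μ] {X : α → ℝ} (hX : Measurable X)
    (hb : ∀ a, X a ∈ Set.Icc (0 : ℝ) 1) {n : ℕ} (hn : 1 ≤ n) :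
    ∫ z : Fin n → α, Real.exp ((max (standardizedDeficit n (∫ b, X b ∂μ)
        ((1 / (n : ℝ)) * ∑ i, X (z i))) 0) ^ 2 / 2) ∂(Measure.pi fun _ => μ)
      ≤ 2 * Real.sqrt n := by
  have hp : ∫ b, X b ∂μ ∈ Set.Icc (0 : ℝ) 1 := by
    have hXi : Integrable X μ := Integrable.of_mem_Icc 0 1 hX.aemeasurable (ae_of_all _ hb)
    refine ⟨integral_nonneg fun a => (hb a).1, ?_⟩
    simpa using integral_mono hXi (integrable_const (1 : ℝ)) fun a => (hb a).2
  set p := ∫ b, X b ∂μ with hpdef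
  set S : (Fin n → α) → ℝ := fun z => standardizedDeficit n p ((1 / (n : ℝ)) * ∑ i, X (z i))
    with hS
  have hq : ∀ z : Fin n → α, 0 ≤ (1 / (n : ℝ)) * ∑ i, X (z i) := fun z =>
    mul_nonneg (by positivity) (Finset.sum_nonneg fun i _ => (hb _).1)
  have hSm : Measurable S := by
    simp only [hS, standardizedDeficit]
    fun_prop
  rcases hn.eq_or_lt with h1 | h2
  · subst h1
    calc ∫ z, Real.exp ((max (S z) 0) ^ 2 / 2) ∂(Measure.pi fun _ => μ)
        ≤ ∫ _z : Fin 1 → α, (1.65 : ℝ) ∂(Measure.pi fun _ => μ) := by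
          refine integral_mono_of_nonneg (ae_of_all _ fun z => (Real.exp_pos _).le)
            (integrable_const _) (ae_of_all _ fun z => ?_)
          refine (Real.exp_le_exp.2 ?_).trans exp_half_le
          have h : (max (S z) 0) ^ 2 / 2 ≤ ((1 : ℕ) : ℝ) / 2 :=
            sq_max_standardizedDeficit_div_two_le hp (hq z)
          rwa [Nat.cast_one] at h
      _ ≤ 2 * Real.sqrt (1 : ℕ) := by simp; norm_num
  · obtain ⟨k, hk, hk'⟩ := exists_grid_size h2
    have hint : ∀ s : ℝ, 0 ≤ s → Integrable (fun z => Real.exp (s * S z))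
        (Measure.pi fun _ : Fin n => μ) := by
      intro s hs
      refine Integrable.of_mem_Icc 0 (Real.exp (s * Real.sqrt n)) (by fun_prop)
        (ae_of_all _ fun z => ⟨(Real.exp_pos _).le, Real.exp_le_exp.2 ?_⟩)
      exact mul_le_mul_of_nonneg_left (standardizedDeficit_le_sqrt hp (hq z)) hs
    have hint' : Integrable (fun z => ∑ j ∈ Finset.range k,
        Real.exp (-((2 * (j : ℝ) + 1) ^ 2 / 2)) * Real.exp ((2 * (j : ℝ) + 1) * S z))
        (Measure.pi fun _ : Fin n => μ) :=
      integrable_finsetSum _ fun j _ => (hint _ (by positivity)).const_mul _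
    calc ∫ z, Real.exp ((max (S z) 0) ^ 2 / 2) ∂(Measure.pi fun _ => μ)
        ≤ ∫ z, 1 + Real.exp (1 / 2) * ∑ j ∈ Finset.range k,
            Real.exp (-((2 * (j : ℝ) + 1) ^ 2 / 2)) * Real.exp ((2 * (j : ℝ) + 1) * S z)
            ∂(Measure.pi fun _ => μ) := by
          refine integral_mono_of_nonneg (ae_of_all _ fun z => (Real.exp_pos _).le)
            ((integrable_const _).add (hint'.const_mul _)) (ae_of_all _ fun z => ?_)
          exact exp_sq_max_div_two_le_sum ((standardizedDeficit_le_sqrt hp (hq z)).trans hk)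
      _ = 1 + Real.exp (1 / 2) * ∑ j ∈ Finset.range k, Real.exp (-((2 * (j : ℝ) + 1) ^ 2 / 2)) *
            ∫ z, Real.exp ((2 * (j : ℝ) + 1) * S z) ∂(Measure.pi fun _ => μ) := by
          rw [integral_add (integrable_const _) (hint'.const_mul _), integral_const_mul,
            integral_finsetSum _ fun j _ => (hint _ (by positivity)).const_mul _]
          simp [integral_const_mul]
      _ ≤ 1 + Real.exp (1 / 2) * ∑ _j ∈ Finset.range k, (1 : ℝ) := by
          gcongr with j _
          calc Real.exp (-((2 * (j : ℝ) + 1) ^ 2 / 2)) *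
                ∫ z, Real.exp ((2 * (j : ℝ) + 1) * S z) ∂(Measure.pi fun _ => μ)
              ≤ Real.exp (-((2 * (j : ℝ) + 1) ^ 2 / 2)) *
                Real.exp ((2 * (j : ℝ) + 1) ^ 2 / 2) :=
                mul_le_mul_of_nonneg_left
                  (integral_exp_mul_standardizedDeficit_le hX hb hn (by positivity))
                  (Real.exp_pos _).le
            _ = 1 := by rw [← Real.exp_add]; simp
      _ ≤ 2 * Real.sqrt n := by simpa using hk'

/-- The Donsker-Varadhan inequality. -/
lemma integral_le_klDiv_add_log_integral_exp {α : Type*} [MeasurableSpace α] {Q Q' : Measure α}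
    [IsProbabilityMeasure Q] [IsProbabilityMeasure Q'] (hQ : Q ≪ Q')
    (hllr : Integrable (fun x => Real.log ((Q.rnDeriv Q') x).toReal) Q) {f : α → ℝ}
    (hf : Integrable f Q) (hexp : Integrable (fun x => Real.exp (f x)) Q') :
    ∫ x, f x ∂Q ≤ klDiv Q Q' + Real.log (∫ x, Real.exp (f x) ∂Q') := by
  have : IsProbabilityMeasure (Q'.tilted f) := isProbabilityMeasure_tilted hexp
  have h := InformationTheory.integral_llr_add_sub_measure_univ_nonneg
    (hQ.trans (absolutelyContinuous_tilted hexp)) (integrable_llr_tilted_right hQ hf hllr hexp)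
  rw [integral_llr_tilted_right hQ hf hexp hllr] at h
  simp only [probReal_univ, llr] at h
  unfold klDiv
  linarith

lemma le_sq_sqrt_add_sqrt {p q e : ℝ} (hp : 0 ≤ p) (hq : 0 ≤ q) (he : 0 ≤ e)
    (h : ∀ t, 0 ≤ t → t * (p - q) - t ^ 2 * p / 2 ≤ 2 * e) :
    p ≤ (Real.sqrt (q + e) + Real.sqrt e) ^ 2 := by
  have ha := Real.sqrt_nonneg (q + e)
  have hb := Real.sqrt_nonneg e
  have ha2 : Real.sqrt (q + e) ^ 2 = q + e := Real.sq_sqrt (by positivity)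
  have hb2 : Real.sqrt e ^ 2 = e := Real.sq_sqrt he
  set a := Real.sqrt (q + e)
  set b := Real.sqrt e
  rcases le_or_gt p q with hpq | hpq
  · nlinarith [mul_nonneg ha hb]
  · have hp' : 0 < p := hq.trans_lt hpq
    have h1 := h ((p - q) / p) (div_nonneg (by linarith) hp)
    have h2 : (p - q) / p * (p - q) - ((p - q) / p) ^ 2 * p / 2 = (p - q) ^ 2 / (2 * p) := by
      field_simp
      ring
    rw [h2, div_le_iff₀ (by positivity)] at h1
    have h3 : p - q ≤ 2 * (Real.sqrt p * b) := by
      refine abs_le_of_sq_le_sq' ?_ (by positivity) |>.2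
      rw [mul_pow, mul_pow, Real.sq_sqrt hp, hb2]
      linarith
    have h4 : Real.sqrt p ^ 2 = p := Real.sq_sqrt hp
    have h5 : Real.sqrt p - b ≤ a := by
      refine abs_le_of_sq_le_sq' ?_ ha |>.2
      nlinarith
    calc p = Real.sqrt p ^ 2 := h4.symm
      _ ≤ (a + b) ^ 2 := pow_le_pow_left₀ (Real.sqrt_nonneg _) (by linarith) 2

/-- The quadratic bound holds for every posterior as soon as the exponential moment of the
standardized deficit under the prior is at most `c`. -/
lemma integral_le_sq_of_integral_exp_le {α : Type*} [MeasurableSpace α] {Q Q' : Measure α}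
    [IsProbabilityMeasure Q] [IsProbabilityMeasure Q'] (hQ : Q ≪ Q')
    (hllr : Integrable (fun x => Real.log ((Q.rnDeriv Q') x).toReal) Q) {n : ℕ} (hn : 1 ≤ n)
    {L E : α → ℝ} (hLm : Measurable L) (hEm : Measurable E)
    (hL : ∀ w, L w ∈ Set.Icc (0 : ℝ) 1) (hE : ∀ w, E w ∈ Set.Icc (0 : ℝ) 1) {c : ℝ}
    (hc : ∫ w, Real.exp ((max (standardizedDeficit n (L w) (E w)) 0) ^ 2 / 2) ∂Q' ≤ c) :
    ∫ w, L w ∂Q ≤ (Real.sqrt ((∫ w, E w ∂Q) + (klDiv Q Q' + Real.log c) / (2 * n)) +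
      Real.sqrt ((klDiv Q Q' + Real.log c) / (2 * n))) ^ 2 := by
  have hn0 : (0 : ℝ) < n := by exact_mod_cast hn
  set F : α → ℝ := fun w => (max (standardizedDeficit n (L w) (E w)) 0) ^ 2 / 2 with hF
  have hFm : Measurable F := by
    simp only [hF, standardizedDeficit]
    fun_prop
  have hFb : ∀ w, F w ∈ Set.Icc (0 : ℝ) (n / 2) := fun w =>
    ⟨by positivity, sq_max_standardizedDeficit_div_two_le (hL w) (hE w).1⟩
  have hexp : Integrable (fun w => Real.exp (F w)) Q' :=
    Integrable.of_mem_Icc 0 (Real.exp (n / 2)) hFm.exp.aemeasurable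
      (ae_of_all _ fun w => ⟨(Real.exp_pos _).le, Real.exp_le_exp.2 (hFb w).2⟩)
  have hFi : Integrable F Q := Integrable.of_mem_Icc 0 (n / 2) hFm.aemeasurable (ae_of_all _ hFb)
  have hLi : Integrable L Q := Integrable.of_mem_Icc 0 1 hLm.aemeasurable (ae_of_all _ hL)
  have hEi : Integrable E Q := Integrable.of_mem_Icc 0 1 hEm.aemeasurable (ae_of_all _ hE)
  have hDV : ∫ w, F w ∂Q ≤ klDiv Q Q' + Real.log c :=
    (integral_le_klDiv_add_log_integral_exp hQ hllr hFi hexp).trans <| by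
      linarith [Real.log_le_log (integral_exp_pos hexp) hc]
  have hF0 : 0 ≤ ∫ w, F w ∂Q := integral_nonneg fun w => (hFb w).1
  refine le_sq_sqrt_add_sqrt (integral_nonneg fun w => (hL w).1)
    (integral_nonneg fun w => (hE w).1) (div_nonneg (hF0.trans hDV) (by positivity))
    fun t ht => ?_
  have h1 : Integrable (fun w => t * (L w - E w)) Q := (hLi.sub hEi).const_mul t
  have h2 : Integrable (fun w => t ^ 2 * L w / 2) Q := (hLi.const_mul _).div_const 2
  have htan : n * (t * ((∫ w, L w ∂Q) - ∫ w, E w ∂Q) - t ^ 2 * (∫ w, L w ∂Q) / 2)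
      ≤ ∫ w, F w ∂Q := by
    have h := integral_mono ((h1.sub h2).const_mul (n : ℝ)) hFi fun w =>
      tangent_le_sq_max_standardizedDeficit (n := n) (hL w).1 (hE w).1 ht
    simp only [Pi.sub_apply] at h
    rwa [integral_const_mul, integral_sub h1 h2, integral_const_mul, integral_sub hLi hEi,
      integral_div, integral_const_mul] at h
  rw [show 2 * ((klDiv Q Q' + Real.log c) / (2 * n)) = (klDiv Q Q' + Real.log c) / n by
    field_simp, le_div_iff₀ hn0]
  linarith

/-- Markov's inequality for a prior average of jointly measurable nonnegative functions with
uniformly bounded expectation. -/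
lemma ofReal_one_sub_le_measure_integral_le {α β : Type*} [MeasurableSpace α] [MeasurableSpace β]
    {μ : Measure α} {ν : Measure β} [IsProbabilityMeasure μ] [IsProbabilityMeasure ν]
    {H : α → β → ℝ} (hH : Measurable (Function.uncurry H)) {B : ℝ}
    (hHb : ∀ a b, H a b ∈ Set.Icc 0 B) {C δ : ℝ} (hC : 0 < C) (hδ : 0 < δ)
    (hHC : ∀ b, ∫ a, H a b ∂μ ≤ C) :
    ENNReal.ofReal (1 - δ) ≤ μ {a | ∫ b, H a b ∂ν ≤ C / δ} := by
  have hHa : ∀ a, Integrable (H a) ν := fun a =>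
    Integrable.of_mem_Icc 0 B (hH.comp (measurable_const.prodMk measurable_id)).aemeasurable
      (ae_of_all _ (hHb a))
  have hHi : ∀ b, Integrable (fun a => H a b) μ := fun b =>
    Integrable.of_mem_Icc 0 B (hH.comp (measurable_id.prodMk measurable_const)).aemeasurable
      (ae_of_all _ fun a => hHb a b)
  have hjoint : Measurable (Function.uncurry fun a b => ENNReal.ofReal (H a b)) :=
    hH.ennreal_ofReal
  set G : α → ENNReal := fun a => ∫⁻ b, ENNReal.ofReal (H a b) ∂ν with hG
  have hGm : Measurable G := hjoint.lintegral_prod_right'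
  have hGint : ∫⁻ a, G a ∂μ ≤ ENNReal.ofReal C := by
    simp only [hG]
    rw [lintegral_lintegral_swap hjoint.aemeasurable]
    calc ∫⁻ b, ∫⁻ a, ENNReal.ofReal (H a b) ∂μ ∂ν ≤ ∫⁻ _b, ENNReal.ofReal C ∂ν := by
          refine lintegral_mono fun b => ?_
          rw [← ofReal_integral_eq_lintegral_ofReal (hHi b) (ae_of_all _ fun a => (hHb a b).1)]
          exact ENNReal.ofReal_le_ofReal (hHC b)
      _ = ENNReal.ofReal C := by simp
  have hc0 : 0 < C / δ := div_pos hC hδ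
  have hbad : μ {a | ENNReal.ofReal (C / δ) ≤ G a} ≤ ENNReal.ofReal δ := by
    have h := (mul_meas_ge_le_lintegral hGm (ENNReal.ofReal (C / δ))).trans hGint
    rw [show ENNReal.ofReal C = ENNReal.ofReal (C / δ) * ENNReal.ofReal δ by
      rw [← ENNReal.ofReal_mul hc0.le, div_mul_cancel₀ _ hδ.ne']] at h
    exact (ENNReal.mul_le_mul_iff_right (by simpa using hc0) ENNReal.ofReal_ne_top).1 h
  calc ENNReal.ofReal (1 - δ) ≤ μ {a | ENNReal.ofReal (C / δ) ≤ G a}ᶜ := by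
        rw [prob_compl_eq_one_sub (measurableSet_le measurable_const hGm),
          ENNReal.ofReal_sub _ hδ.le, ENNReal.ofReal_one]
        exact tsub_le_tsub_left hbad 1
    _ ≤ μ {a | ∫ b, H a b ∂ν ≤ C / δ} := by
        refine measure_mono fun a ha => ?_
        have h : G a < ENNReal.ofReal (C / δ) := not_le.1 ha
        simp only [hG] at h
        rw [← ofReal_integral_eq_lintegral_ofReal (hHa a)
          (ae_of_all _ fun b => (hHb a b).1)] at h
        exact ((ENNReal.ofReal_lt_ofReal_iff hc0).1 h).le

/-- **PAC-Bayes-quadratic bound.**  Let `P` be a probability measure on a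
measurable space `𝒵`, let `ℓ : 𝒲 × 𝒵 → ℝ` be a jointly measurable loss with
values in `[0,1]`, and define the risk `L w = ∫ ℓ(w,z) dP(z)` and the empirical
risk `L̂ₙ(w, z) = (1/n)·∑ᵢ ℓ(w, zᵢ)` on a sample `z ∈ 𝒵ⁿ`.  Fix a prior
probability measure `Q⁰` on `𝒲`, `n ≥ 1` and `δ ∈ (0,1)`.  Then with
probability at least `1 - δ` over size-`n` i.i.d. samples from `P`,
simultaneously for all posterior probability measures `Q` on `𝒲` (those with
infinite KL divergence to `Q⁰` satisfy the bound trivially, so we quantify over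
the `Q` with `Q ≪ Q⁰` and integrable log-density, i.e. finite KL):
`Q[L] ≤ (√(Q[L̂ₙ] + (KL(Q‖Q⁰) + log(2√n/δ))/(2n)) + √((KL(Q‖Q⁰) + log(2√n/δ))/(2n)))²`. -/
theorem pac_bayes_quadratic_bound
    {𝒵 𝒲 : Type*} [MeasurableSpace 𝒵] [MeasurableSpace 𝒲]
    (P : Measure 𝒵) [IsProbabilityMeasure P]
    (ℓ : 𝒲 × 𝒵 → ℝ) (hℓmeas : Measurable ℓ)
    (hℓbdd : ∀ p, ℓ p ∈ Set.Icc (0 : ℝ) 1)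
    (Q0 : Measure 𝒲) [IsProbabilityMeasure Q0]
    (n : ℕ) (hn : 1 ≤ n) (δ : ℝ) (hδ : δ ∈ Set.Ioo (0 : ℝ) 1) :
    ENNReal.ofReal (1 - δ) ≤
      (Measure.pi fun _ : Fin n => P)
        {z : Fin n → 𝒵 |
          ∀ Q : Measure 𝒲, IsProbabilityMeasure Q → Q ≪ Q0 →
            Integrable (fun w => Real.log ((Q.rnDeriv Q0) w).toReal) Q →
            ∫ w, (∫ zz, ℓ (w, zz) ∂P) ∂Q ≤
              (Real.sqrt
                  ((∫ w, (1 / (n : ℝ)) * ∑ i : Fin n, ℓ (w, z i) ∂Q) +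
                    (klDiv Q Q0 + Real.log (2 * Real.sqrt n / δ)) / (2 * n)) +
                Real.sqrt
                  ((klDiv Q Q0 + Real.log (2 * Real.sqrt n / δ)) / (2 * n))) ^ 2} := by
  have hn0 : (0 : ℝ) < n := by exact_mod_cast hn
  have hLm : Measurable fun w => ∫ zz, ℓ (w, zz) ∂P :=
    (hℓmeas.stronglyMeasurable.integral_prod_right' (ν := P)).measurable
  have hLb : ∀ w, ∫ zz, ℓ (w, zz) ∂P ∈ Set.Icc (0 : ℝ) 1 := fun w => by
    have hi : Integrable (fun zz => ℓ (w, zz)) P :=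
      Integrable.of_mem_Icc 0 1 (by fun_prop) (ae_of_all _ fun _ => hℓbdd _)
    refine ⟨integral_nonneg fun _ => (hℓbdd _).1, ?_⟩
    simpa using integral_mono hi (integrable_const (1 : ℝ)) fun _ => (hℓbdd _).2
  have hEb : ∀ (z : Fin n → 𝒵) (w : 𝒲),
      (1 / (n : ℝ)) * ∑ i : Fin n, ℓ (w, z i) ∈ Set.Icc (0 : ℝ) 1 := fun z w => by
    refine ⟨mul_nonneg (by positivity) (Finset.sum_nonneg fun _ _ => (hℓbdd _).1), ?_⟩
    have : ∑ i : Fin n, ℓ (w, z i) ≤ n := by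
      simpa using Finset.sum_le_sum fun (i : Fin n) (_ : i ∈ Finset.univ) => (hℓbdd (w, z i)).2
    rwa [one_div_mul_eq_div, div_le_one hn0]
  have hHm : Measurable (Function.uncurry fun (z : Fin n → 𝒵) (w : 𝒲) =>
      Real.exp ((max (standardizedDeficit n (∫ zz, ℓ (w, zz) ∂P)
        ((1 / (n : ℝ)) * ∑ i : Fin n, ℓ (w, z i))) 0) ^ 2 / 2)) := by
    have hL2 : Measurable fun x : (Fin n → 𝒵) × 𝒲 => ∫ zz, ℓ (x.2, zz) ∂P :=
      hLm.comp measurable_snd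
    have hE2 : Measurable fun x : (Fin n → 𝒵) × 𝒲 =>
        (1 / (n : ℝ)) * ∑ i : Fin n, ℓ (x.2, x.1 i) := by
      fun_prop
    have hD : Measurable fun x : (Fin n → 𝒵) × 𝒲 => standardizedDeficit n
        (∫ zz, ℓ (x.2, zz) ∂P) ((1 / (n : ℝ)) * ∑ i : Fin n, ℓ (x.2, x.1 i)) :=
      ((hL2.sub hE2).const_mul _).div hL2.sqrt
    exact (((hD.max measurable_const).pow_const 2).div_const 2).exp
  refine (ofReal_one_sub_le_measure_integral_le (ν := Q0) (B := Real.exp (n / 2)) hHm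
    (fun z w => ⟨(Real.exp_pos _).le, Real.exp_le_exp.2
      (sq_max_standardizedDeficit_div_two_le (hLb w) (hEb z w).1)⟩)
    (mul_pos two_pos (Real.sqrt_pos.2 hn0)) hδ.1 fun w =>
      integral_exp_sq_max_standardizedDeficit_le (X := fun zz => ℓ (w, zz)) (by fun_prop)
        (fun _ => hℓbdd _) hn).trans (measure_mono fun z hz Q hQp hQ hllr => ?_)
  exact integral_le_sq_of_integral_exp_le hQ hllr hn hLm (by fun_prop) hLb (hEb z) hz
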